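/- Let g ≥ 2 and let d ≥ 2 be even. The map m'_2 : Γ_g[d²,2d²] → (ℤ/2ℤ)^{2g²−g} defined on A = I + d²A' by m'_2(A) := ({p_{ij}(A) mod 2}_{1≤i,j≤g}, {q_{ij}(A) mod 2}_{1≤i<j≤g}, {r_{ij}(A) mod 2}_{1≤i<j≤g}) is a surjective group homomorphism with kernel Γ_g[2d²]; hence it induces an isomorphism Γ_g[d²,2d²]/Γ_g[2d²] ≅ (ℤ/2ℤ)^{2g²−g}. -/

import Mathlib

open Matrix

/-- The index type for `2g × 2g` matrices, written as `Fin g ⊕ Fin g`. -/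
abbrev Idx (g : ℕ) := Fin g ⊕ Fin g

/-- The integral symplectic group `Sp(2g; ℤ)`. -/
abbrev SpZ (g : ℕ) := Matrix.symplecticGroup (Fin g) ℤ

/-- Entrywise reduction of integral matrices mod `d`. -/
def modred (g d : ℕ) : Matrix (Idx g) (Idx g) ℤ →+* Matrix (Idx g) (Idx g) (ZMod d) :=
  (Int.castRingHom (ZMod d)).mapMatrix

/-- The level `d` congruence subgroup `Γ_g[d]` of `Sp(2g; ℤ)`:
matrices congruent to the identity mod `d`. -/
def Gamma (g d : ℕ) : Subgroup ↥(SpZ g) where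
  carrier := {A | modred g d (A : Matrix (Idx g) (Idx g) ℤ) = 1}
  one_mem' := by
    simp [Set.mem_setOf_eq]
  mul_mem' := by
    intro a b ha hb
    simp only [Set.mem_setOf_eq, Submonoid.coe_mul, _root_.map_mul] at *
    rw [ha, hb, one_mul]
  inv_mem' := by
    intro a ha
    simp only [Set.mem_setOf_eq] at *
    have h : modred g d ((a⁻¹ : ↥(SpZ g)) : Matrix (Idx g) (Idx g) ℤ) *
        modred g d ((a : ↥(SpZ g)) : Matrix (Idx g) (Idx g) ℤ) = 1 := by
      rw [← _root_.map_mul, ← Submonoid.coe_mul, inv_mul_cancel, Submonoid.coe_one, _root_.map_one]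
    calc modred g d ((a⁻¹ : ↥(SpZ g)) : Matrix (Idx g) (Idx g) ℤ)
        = modred g d ((a⁻¹ : ↥(SpZ g)) : Matrix (Idx g) (Idx g) ℤ) *
            modred g d ((a : ↥(SpZ g)) : Matrix (Idx g) (Idx g) ℤ) := by rw [ha, mul_one]
      _ = 1 := h

lemma mem_Gamma_iff {g d : ℕ} {A : ↥(SpZ g)} :
    A ∈ Gamma g d ↔ ∀ i j : Idx g, (d : ℤ) ∣
      ((A : Matrix (Idx g) (Idx g) ℤ) i j - (1 : Matrix (Idx g) (Idx g) ℤ) i j) := by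
  have : A ∈ Gamma g d ↔ modred g d (A : Matrix (Idx g) (Idx g) ℤ) = 1 := Iff.rfl
  rw [this, ← Matrix.ext_iff]
  constructor
  · intro h i j
    have hij := h i j
    simp only [modred, RingHom.mapMatrix_apply, Matrix.map_apply, Int.coe_castRingHom] at hij
    have h1 : ((1 : Matrix (Idx g) (Idx g) ℤ) i j : ZMod d) = (1 : Matrix (Idx g) (Idx g) (ZMod d)) i j := by
      by_cases hij' : i = j <;> simp [Matrix.one_apply, hij']
    rw [← h1] at hij
    rw [← ZMod.intCast_zmod_eq_zero_iff_dvd]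
    push_cast
    rw [hij]
    ring
  · intro h i j
    have hij := h i j
    rw [← ZMod.intCast_zmod_eq_zero_iff_dvd] at hij
    push_cast at hij
    simp only [modred, RingHom.mapMatrix_apply, Matrix.map_apply, Int.coe_castRingHom]
    have h1 : ((1 : Matrix (Idx g) (Idx g) ℤ) i j : ZMod d) = (1 : Matrix (Idx g) (Idx g) (ZMod d)) i j := by
      by_cases hij' : i = j <;> simp [Matrix.one_apply, hij']
    rw [← h1]
    linear_combination hij
lemma Gamma_entry_dvd {g d : ℕ} {A : ↥(SpZ g)} (hA : A ∈ Gamma g d) {i j : Idx g}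
    (hij : i ≠ j) : (d : ℤ) ∣ (A : Matrix (Idx g) (Idx g) ℤ) i j := by
  have := mem_Gamma_iff.mp hA i j
  rwa [Matrix.one_apply_ne hij, sub_zero] at this

lemma Gamma_one_sub_dvd {g d : ℕ} {A : ↥(SpZ g)} (hA : A ∈ Gamma g d) (i j : Idx g) :
    (d : ℤ) ∣ ((1 : Matrix (Idx g) (Idx g) ℤ) - (A : Matrix (Idx g) (Idx g) ℤ)) i j := by
  have h := mem_Gamma_iff.mp hA i j
  have he : ((1 : Matrix (Idx g) (Idx g) ℤ) - (A : Matrix (Idx g) (Idx g) ℤ)) i j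
      = -((A : Matrix (Idx g) (Idx g) ℤ) i j - (1 : Matrix (Idx g) (Idx g) ℤ) i j) := by
    rw [Matrix.sub_apply]; ring
  rw [he]
  exact dvd_neg.mpr h

lemma two_d_dvd_d_mul_d {d : ℕ} (hd : Even d) : (2 * d : ℤ) ∣ (d : ℤ) * (d : ℤ) := by
  obtain ⟨e, he⟩ := hd
  refine ⟨(e : ℤ), ?_⟩
  push_cast [he]
  ring

/-- The subgroup `Γ_g[d, 2d]` (for even `d`) of `Γ_g[d]`: matrices `A = I + dA'` such that
the diagonal entries of the upper-right and lower-left `g×g` blocks of `A'` are even,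
i.e. the `(inl i, inr i)` and `(inr i, inl i)` entries of `A` are divisible by `2d`. -/
def GammaMod (g : ℕ) (d : ℕ) (hd : Even d) : Subgroup ↥(SpZ g) where
  carrier := {A | A ∈ Gamma g d ∧ ∀ i : Fin g,
    (2 * d : ℤ) ∣ (A : Matrix (Idx g) (Idx g) ℤ) (Sum.inl i) (Sum.inr i) ∧
    (2 * d : ℤ) ∣ (A : Matrix (Idx g) (Idx g) ℤ) (Sum.inr i) (Sum.inl i)}
  one_mem' := by
    refine ⟨one_mem _, fun i => ?_⟩
    constructor <;> simp [Matrix.one_apply]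
  mul_mem' := by
    rintro a b ⟨ha1, ha2⟩ ⟨hb1, hb2⟩
    refine ⟨mul_mem ha1 hb1, fun i => ?_⟩
    constructor
    · rw [Submonoid.coe_mul, Matrix.mul_apply]
      refine Finset.dvd_sum fun k _ => ?_
      rcases k with k | k
      · by_cases hk : k = i
        · subst hk
          exact Dvd.dvd.mul_left (hb2 k).1 _
        · refine dvd_trans (two_d_dvd_d_mul_d hd) (mul_dvd_mul ?_ ?_)
          · exact Gamma_entry_dvd ha1 (by simp only [ne_eq, Sum.inl.injEq, Sum.inr.injEq]; first | exact fun h => hk h | exact fun h => hk h.symm)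
          · exact Gamma_entry_dvd hb1 (by simp)
      · by_cases hk : k = i
        · subst hk
          exact Dvd.dvd.mul_right (ha2 k).1 _
        · refine dvd_trans (two_d_dvd_d_mul_d hd) (mul_dvd_mul ?_ ?_)
          · exact Gamma_entry_dvd ha1 (by simp)
          · exact Gamma_entry_dvd hb1 (by simp only [ne_eq, Sum.inl.injEq, Sum.inr.injEq]; first | exact fun h => hk h | exact fun h => hk h.symm)
    · rw [Submonoid.coe_mul, Matrix.mul_apply]
      refine Finset.dvd_sum fun k _ => ?_
      rcases k with k | k
      · by_cases hk : k = i
        · subst hk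
          exact Dvd.dvd.mul_right (ha2 k).2 _
        · refine dvd_trans (two_d_dvd_d_mul_d hd) (mul_dvd_mul ?_ ?_)
          · exact Gamma_entry_dvd ha1 (by simp)
          · exact Gamma_entry_dvd hb1 (by simp only [ne_eq, Sum.inl.injEq, Sum.inr.injEq]; first | exact fun h => hk h | exact fun h => hk h.symm)
      · by_cases hk : k = i
        · subst hk
          exact Dvd.dvd.mul_left (hb2 k).2 _
        · refine dvd_trans (two_d_dvd_d_mul_d hd) (mul_dvd_mul ?_ ?_)
          · exact Gamma_entry_dvd ha1 (by simp only [ne_eq, Sum.inl.injEq, Sum.inr.injEq]; first | exact fun h => hk h | exact fun h => hk h.symm)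
          · exact Gamma_entry_dvd hb1 (by simp)
  inv_mem' := by
    rintro a ⟨ha1, ha2⟩
    refine ⟨inv_mem ha1, fun i => ?_⟩
    have hAA : ((a : ↥(SpZ g)) : Matrix (Idx g) (Idx g) ℤ) *
        ((a⁻¹ : ↥(SpZ g)) : Matrix (Idx g) (Idx g) ℤ) = 1 := by
      rw [← Submonoid.coe_mul, mul_inv_cancel, Submonoid.coe_one]
    have hAA' : ((a⁻¹ : ↥(SpZ g)) : Matrix (Idx g) (Idx g) ℤ) *
        ((a : ↥(SpZ g)) : Matrix (Idx g) (Idx g) ℤ) = 1 := by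
      rw [← Submonoid.coe_mul, inv_mul_cancel, Submonoid.coe_one]
    set X : Matrix (Idx g) (Idx g) ℤ := ((a⁻¹ : ↥(SpZ g)) : Matrix (Idx g) (Idx g) ℤ) with hX
    set A : Matrix (Idx g) (Idx g) ℤ := ((a : ↥(SpZ g)) : Matrix (Idx g) (Idx g) ℤ) with hA
    have key : X = (2 : ℤ) • (1 : Matrix (Idx g) (Idx g) ℤ) - A + (1 - A) * X * (1 - A) := by
      have e1 : ((1 : Matrix (Idx g) (Idx g) ℤ) - A) * X = X - 1 := by
        rw [sub_mul, one_mul, hAA]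
      have e2 : (X - 1) * ((1 : Matrix (Idx g) (Idx g) ℤ) - A) = X - 1 - (1 - A) := by
        rw [sub_mul, one_mul, mul_sub, mul_one, hAA']
      rw [e1, e2]
      have : (2 : ℤ) • (1 : Matrix (Idx g) (Idx g) ℤ) = 1 + 1 := by
        rw [two_smul]
      rw [this]
      abel
    have hprod : ∀ i' j' : Idx g, (2 * d : ℤ) ∣ ((1 - A) * X * (1 - A)) i' j' := by
      intro i' j'
      rw [Matrix.mul_apply]
      refine Finset.dvd_sum fun k _ => ?_
      refine dvd_trans (two_d_dvd_d_mul_d hd) (mul_dvd_mul ?_ ?_)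
      · rw [Matrix.mul_apply]
        refine Finset.dvd_sum fun l _ => ?_
        exact Dvd.dvd.mul_right (Gamma_one_sub_dvd ha1 i' l) _
      · exact Gamma_one_sub_dvd ha1 k j'
    constructor
    · rw [key]
      simp only [Matrix.add_apply, Matrix.sub_apply, Matrix.smul_apply,
        Matrix.one_apply_ne (show (Sum.inl i : Idx g) ≠ Sum.inr i by simp), smul_zero]
      refine dvd_add (dvd_sub (Dvd.intro 0 rfl) ?_) (hprod _ _)
      exact (ha2 i).1
    · rw [key]
      simp only [Matrix.add_apply, Matrix.sub_apply, Matrix.smul_apply,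
        Matrix.one_apply_ne (show (Sum.inr i : Idx g) ≠ Sum.inl i by simp), smul_zero]
      refine dvd_add (dvd_sub (Dvd.intro 0 rfl) ?_) (hprod _ _)
      exact (ha2 i).2

/-- The `(i,j)` entry of the matrix `A' = (A - I)/d`. -/
def entryDiv (g d : ℕ) (A : ↥(SpZ g)) (i j : Idx g) : ℤ :=
  ((A : Matrix (Idx g) (Idx g) ℤ) i j - (1 : Matrix (Idx g) (Idx g) ℤ) i j) / (d : ℤ)

/-- The map `m'_2 : Γ_g[d², 2d²] → (ℤ/2ℤ)^{2g²−g}` given by the `p`-block and the strictly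
upper triangular parts of the `q`- and `r`-blocks of `A' = (A - I)/d²`, reduced mod 2. -/
def m2Map (g d : ℕ) (h : Even (d ^ 2)) (A : ↥(GammaMod g (d ^ 2) h)) :
    ((Fin g × Fin g) → ZMod 2) × ({p : Fin g × Fin g // p.1 < p.2} → ZMod 2) ×
      ({p : Fin g × Fin g // p.1 < p.2} → ZMod 2) :=
  ⟨fun p => (entryDiv g (d ^ 2) (A : ↥(SpZ g)) (Sum.inl p.1) (Sum.inl p.2) : ZMod 2),
   fun p => (entryDiv g (d ^ 2) (A : ↥(SpZ g)) (Sum.inl p.1.1) (Sum.inr p.1.2) : ZMod 2),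
   fun p => (entryDiv g (d ^ 2) (A : ↥(SpZ g)) (Sum.inr p.1.1) (Sum.inl p.1.2) : ZMod 2)⟩

section Entries

variable {g n : ℕ}

lemma entryDiv_mul_cancel {A : ↥(SpZ g)} (hA : A ∈ Gamma g n) (i j : Idx g) :
    (n : ℤ) * entryDiv g n A i j =
      (A : Matrix (Idx g) (Idx g) ℤ) i j - (1 : Matrix (Idx g) (Idx g) ℤ) i j :=
  Int.mul_ediv_cancel' (mem_Gamma_iff.mp hA i j)

lemma coe_eq_one_add_smul_entryDiv {A : ↥(SpZ g)} (hA : A ∈ Gamma g n) :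
    (A : Matrix (Idx g) (Idx g) ℤ) = 1 + (n : ℤ) • Matrix.of (entryDiv g n A) := by
  ext i j
  simp [entryDiv_mul_cancel hA i j]

lemma entryDiv_eq_of_coe_eq (hn : n ≠ 0) {A : ↥(SpZ g)} {X : Matrix (Idx g) (Idx g) ℤ}
    (hA : (A : Matrix (Idx g) (Idx g) ℤ) = 1 + (n : ℤ) • X) (i j : Idx g) :
    entryDiv g n A i j = X i j := by
  have hn' : (n : ℤ) ≠ 0 := by exact_mod_cast hn
  simp [entryDiv, hA, Int.mul_ediv_cancel_left _ hn', -nsmul_eq_mul, -zsmul_eq_mul]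

/-- The map `A ↦ (A - I)/n` is additive mod 2 when `n` is even. -/
lemma entryDiv_mul (hn : n ≠ 0) (hev : Even n) {A B : ↥(SpZ g)} (hA : A ∈ Gamma g n)
    (hB : B ∈ Gamma g n) (i j : Idx g) :
    (entryDiv g n (A * B) i j : ZMod 2) = entryDiv g n A i j + entryDiv g n B i j := by
  set X := Matrix.of (entryDiv g n A) with hX
  set Y := Matrix.of (entryDiv g n B) with hY
  have hAB : ((A * B : ↥(SpZ g)) : Matrix (Idx g) (Idx g) ℤ) =
      1 + (n : ℤ) • (X + Y + (n : ℤ) • (X * Y)) := by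
    rw [Submonoid.coe_mul, coe_eq_one_add_smul_entryDiv hA, coe_eq_one_add_smul_entryDiv hB]
    simp only [add_mul, mul_add, one_mul, mul_one, smul_mul_assoc, mul_smul_comm, smul_add]
    abel
  have hn2 : (n : ZMod 2) = 0 := (ZMod.natCast_eq_zero_iff_even).mpr hev
  rw [entryDiv_eq_of_coe_eq hn hAB]
  simp [hX, hY, hn2, -nsmul_eq_mul, -zsmul_eq_mul]

/-- Mod 2, the matrix `(A - I)/n` lies in the symplectic Lie algebra when `n` is even. -/
lemma entryDiv_mod_two_symplectic (hn : n ≠ 0) (hev : Even n) {A : ↥(SpZ g)}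
    (hA : A ∈ Gamma g n) (i j : Idx g) :
    (((Matrix.of (entryDiv g n A) * Matrix.J (Fin g) ℤ +
      Matrix.J (Fin g) ℤ * (Matrix.of (entryDiv g n A))ᵀ) i j : ℤ) : ZMod 2) = 0 := by
  set X := Matrix.of (entryDiv g n A) with hX
  have hn' : (n : ℤ) ≠ 0 := by exact_mod_cast hn
  have hS := SymplecticGroup.mem_iff.mp A.2
  rw [coe_eq_one_add_smul_entryDiv hA, ← hX] at hS
  simp only [transpose_add, transpose_one, transpose_smul, add_mul, mul_add, one_mul, mul_one,
    smul_mul_assoc, mul_smul_comm] at hS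
  have h0 : (n : ℤ) • (X * Matrix.J (Fin g) ℤ + Matrix.J (Fin g) ℤ * Xᵀ +
      (n : ℤ) • (X * Matrix.J (Fin g) ℤ * Xᵀ)) = 0 := by
    rw [← sub_eq_zero.mpr hS]
    simp only [smul_add]
    abel
  have h1 := congrFun₂ ((smul_eq_zero.mp h0).resolve_left hn') i j
  have h2 := congrArg (Int.cast : ℤ → ZMod 2) h1
  have hn2 : (n : ZMod 2) = 0 := (ZMod.natCast_eq_zero_iff_even).mpr hev
  rw [Matrix.add_apply _ ((n : ℤ) • _), Matrix.smul_apply, smul_eq_mul] at h2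
  push_cast at h2
  simpa [hn2] using h2

lemma entryDiv_inr_inr (hn : n ≠ 0) (hev : Even n) {A : ↥(SpZ g)} (hA : A ∈ Gamma g n)
    (i j : Fin g) : (entryDiv g n A (Sum.inr i) (Sum.inr j) : ZMod 2) =
      entryDiv g n A (Sum.inl j) (Sum.inl i) := by
  have h := entryDiv_mod_two_symplectic hn hev hA (Sum.inr i) (Sum.inl j)
  simp [Matrix.J, Matrix.mul_apply, Matrix.one_apply] at h
  rwa [CharTwo.add_eq_zero] at h

lemma entryDiv_inl_inr_symm (hn : n ≠ 0) (hev : Even n) {A : ↥(SpZ g)} (hA : A ∈ Gamma g n)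
    (i j : Fin g) : (entryDiv g n A (Sum.inl i) (Sum.inr j) : ZMod 2) =
      entryDiv g n A (Sum.inl j) (Sum.inr i) := by
  have h := entryDiv_mod_two_symplectic hn hev hA (Sum.inl i) (Sum.inl j)
  simp [Matrix.J, Matrix.mul_apply, Matrix.one_apply] at h
  rwa [CharTwo.add_eq_zero] at h

lemma entryDiv_inr_inl_symm (hn : n ≠ 0) (hev : Even n) {A : ↥(SpZ g)} (hA : A ∈ Gamma g n)
    (i j : Fin g) : (entryDiv g n A (Sum.inr i) (Sum.inl j) : ZMod 2) =
      entryDiv g n A (Sum.inr j) (Sum.inl i) := by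
  have h := entryDiv_mod_two_symplectic hn hev hA (Sum.inr i) (Sum.inr j)
  simp [Matrix.J, Matrix.mul_apply, Matrix.one_apply] at h
  rwa [CharTwo.add_eq_zero] at h

lemma entryDiv_eq_zero_iff (hn : n ≠ 0) {A : ↥(SpZ g)} (hA : A ∈ Gamma g n) (i j : Idx g) :
    (entryDiv g n A i j : ZMod 2) = 0 ↔ ((2 * n : ℕ) : ℤ) ∣
      (A : Matrix (Idx g) (Idx g) ℤ) i j - (1 : Matrix (Idx g) (Idx g) ℤ) i j := by
  have hn' : (n : ℤ) ≠ 0 := by exact_mod_cast hn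
  rw [← entryDiv_mul_cancel hA i j, ZMod.intCast_zmod_eq_zero_iff_dvd, mul_comm 2 n,
    Nat.cast_mul, mul_dvd_mul_iff_left hn']

lemma exists_entryDiv_eq (hn : n ≠ 0) (hev : Even n) {X : Matrix (Idx g) (Idx g) ℤ}
    (hX : 1 + (n : ℤ) • X ∈ SpZ g)
    (hq : ∀ i : Fin g, (2 : ℤ) ∣ X (Sum.inl i) (Sum.inr i))
    (hr : ∀ i : Fin g, (2 : ℤ) ∣ X (Sum.inr i) (Sum.inl i)) :
    ∃ A : ↥(GammaMod g n hev), ∀ i j, entryDiv g n (A : ↥(SpZ g)) i j = X i j := by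
  refine ⟨⟨⟨_, hX⟩, mem_Gamma_iff.mpr fun i j => ?_, fun i => ⟨?_, ?_⟩⟩,
    entryDiv_eq_of_coe_eq hn rfl⟩
  · simp [-nsmul_eq_mul, -zsmul_eq_mul]
  · simpa [mul_comm (2 : ℤ), -nsmul_eq_mul, -zsmul_eq_mul] using mul_dvd_mul_left (n : ℤ) (hq i)
  · simpa [mul_comm (2 : ℤ), -nsmul_eq_mul, -zsmul_eq_mul] using mul_dvd_mul_left (n : ℤ) (hr i)

end Entries

section Unipotent

variable {g : ℕ}

lemma fromBlocks_upper_mem {B : Matrix (Fin g) (Fin g) ℤ} (hB : B.IsSymm) :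
    fromBlocks 1 B 0 1 ∈ SpZ g := by
  rw [SymplecticGroup.mem_iff]
  simp [Matrix.J, fromBlocks_transpose, fromBlocks_multiply, hB.eq]

lemma fromBlocks_lower_mem {C : Matrix (Fin g) (Fin g) ℤ} (hC : C.IsSymm) :
    fromBlocks 1 0 C 1 ∈ SpZ g := by
  rw [SymplecticGroup.mem_iff]
  simp [Matrix.J, fromBlocks_transpose, fromBlocks_multiply, hC.eq]

/-- The commutator of lower and upper unipotent matrices with blocks `-dT` and `dS`. -/
lemma one_add_sq_smul_fromBlocks_mem (d : ℕ) {S T : Matrix (Fin g) (Fin g) ℤ}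
    (hS : S.IsSymm) (hT : T.IsSymm) :
    1 + ((d ^ 2 : ℕ) : ℤ) • fromBlocks (S * T) (-(d : ℤ) • (S * T * S))
      (-(d : ℤ) • (T * S * T)) (-(T * S) + (d : ℤ) ^ 2 • (T * S * T * S)) ∈ SpZ g := by
  have h := mul_mem (mul_mem (mul_mem
    (fromBlocks_lower_mem (hT.smul (-(d : ℤ)))) (fromBlocks_upper_mem (hS.smul (d : ℤ))))
    (fromBlocks_lower_mem (hT.smul (d : ℤ)))) (fromBlocks_upper_mem (hS.smul (-(d : ℤ))))
  convert h using 1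
  rw [← fromBlocks_one]
  simp only [fromBlocks_multiply, fromBlocks_smul, fromBlocks_add, one_mul, mul_one, mul_zero,
    add_zero, zero_add, Nat.cast_pow]
  congr 1 <;>
  · simp only [smul_mul_assoc, mul_smul_comm, smul_smul, add_mul, one_mul,
      smul_add, mul_assoc, smul_neg, neg_smul, neg_mul, mul_neg]
    module

end Unipotent

section Surjectivity

variable {g d : ℕ}

/-- A symmetric integral matrix with zero diagonal lifting `f` above the diagonal. -/
def symmLift (f : {p : Fin g × Fin g // p.1 < p.2} → ZMod 2) : Matrix (Fin g) (Fin g) ℤ :=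
  fun i j => if h : i < j then ((f ⟨(i, j), h⟩).val : ℤ)
    else if h : j < i then ((f ⟨(j, i), h⟩).val : ℤ) else 0

lemma symmLift_isSymm (f : {p : Fin g × Fin g // p.1 < p.2} → ZMod 2) :
    (symmLift f).IsSymm := by
  ext i j
  rcases lt_trichotomy i j with h | h | h
  · simp [symmLift, h, h.not_gt]
  · simp [h]
  · simp [symmLift, h, h.not_gt]

lemma symmLift_diag (f : {p : Fin g × Fin g // p.1 < p.2} → ZMod 2) (i : Fin g) :
    symmLift f i i = 0 := by
  simp [symmLift]

lemma symmLift_upper (f : {p : Fin g × Fin g // p.1 < p.2} → ZMod 2)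
    (p : {p : Fin g × Fin g // p.1 < p.2}) : ((symmLift f p.1.1 p.1.2 : ℤ) : ZMod 2) = f p := by
  simp [symmLift, p.2]

lemma exists_m2Map_eq_upper (hd : d ≠ 0) (h : Even (d ^ 2))
    (f : {p : Fin g × Fin g // p.1 < p.2} → ZMod 2) : ∃ A, m2Map g d h A = (0, f, 0) := by
  have hX : 1 + ((d ^ 2 : ℕ) : ℤ) • fromBlocks 0 (symmLift f) 0 0 ∈ SpZ g := by
    rw [← fromBlocks_one, fromBlocks_smul, fromBlocks_add]
    simpa only [smul_zero, add_zero, zero_add] using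
      fromBlocks_upper_mem ((symmLift_isSymm f).smul ((d ^ 2 : ℕ) : ℤ))
  obtain ⟨A, hA⟩ := exists_entryDiv_eq (pow_ne_zero 2 hd) h hX
    (by simp [symmLift_diag]) (by simp)
  refine ⟨A, ?_⟩
  ext p <;> simp [m2Map, hA, symmLift_upper]

lemma exists_m2Map_eq_lower (hd : d ≠ 0) (h : Even (d ^ 2))
    (f : {p : Fin g × Fin g // p.1 < p.2} → ZMod 2) : ∃ A, m2Map g d h A = (0, 0, f) := by
  have hX : 1 + ((d ^ 2 : ℕ) : ℤ) • fromBlocks 0 0 (symmLift f) 0 ∈ SpZ g := by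
    rw [← fromBlocks_one, fromBlocks_smul, fromBlocks_add]
    simpa only [smul_zero, add_zero, zero_add] using
      fromBlocks_lower_mem ((symmLift_isSymm f).smul ((d ^ 2 : ℕ) : ℤ))
  obtain ⟨A, hA⟩ := exists_entryDiv_eq (pow_ne_zero 2 hd) h hX
    (by simp) (by simp [symmLift_diag])
  refine ⟨A, ?_⟩
  ext p <;> simp [m2Map, hA, symmLift_upper]

lemma exists_m2Map_eq_single (hd : d ≠ 0) (hdeven : Even d) (h : Even (d ^ 2))
    (p : Fin g × Fin g) (c : ZMod 2) : ∃ A, m2Map g d h A = (Pi.single p c, 0, 0) := by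
  obtain ⟨i, j⟩ := p
  let S : Matrix (Fin g) (Fin g) ℤ := diagonal (Pi.single i (c.val : ℤ))
  let T : Matrix (Fin g) (Fin g) ℤ :=
    fun k l => if (k = i ∧ l = j) ∨ (k = j ∧ l = i) then 1 else 0
  have hS : S.IsSymm := isSymm_diagonal _
  have hT : T.IsSymm := by
    ext k l
    grind [transpose_apply]
  have hd2 : (2 : ℤ) ∣ d := by exact_mod_cast hdeven.two_dvd
  have hdz : (d : ZMod 2) = 0 := (ZMod.natCast_eq_zero_iff_even).mpr hdeven
  obtain ⟨A, hA⟩ := exists_entryDiv_eq (pow_ne_zero 2 hd) h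
    (one_add_sq_smul_fromBlocks_mem d hS hT)
    (fun k => by simpa [-nsmul_eq_mul, -zsmul_eq_mul] using hd2.mul_right _)
    (fun k => by simpa [-nsmul_eq_mul, -zsmul_eq_mul] using hd2.mul_right _)
  refine ⟨A, ?_⟩
  ext p
  · obtain ⟨k, l⟩ := p
    have hST : (S * T) k l = if k = i ∧ l = j then (c.val : ℤ) else 0 := by
      refine (diagonal_mul _ _ _ _).trans ?_
      simp only [T, Pi.single_apply]
      grind
    simp only [m2Map, hA, fromBlocks_apply₁₁, hST, Pi.single_apply, Prod.mk.injEq]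
    split_ifs <;> simp
  · simp [m2Map, hA, hdz, -nsmul_eq_mul, -zsmul_eq_mul]
  · simp [m2Map, hA, hdz, -nsmul_eq_mul, -zsmul_eq_mul]

lemma m2Map_mul (hd : d ≠ 0) (h : Even (d ^ 2)) (A B : ↥(GammaMod g (d ^ 2) h)) :
    m2Map g d h (A * B) = m2Map g d h A + m2Map g d h B := by
  ext p <;> exact entryDiv_mul (pow_ne_zero 2 hd) h A.2.1 B.2.1 _ _

lemma m2Map_surjective (hd : d ≠ 0) (hdeven : Even d) (h : Even (d ^ 2)) :
    Function.Surjective (m2Map g d h) := by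
  have hadd : ∀ x y, (∃ A, m2Map g d h A = x) → (∃ A, m2Map g d h A = y) →
      ∃ A, m2Map g d h A = x + y := by
    rintro _ _ ⟨A, rfl⟩ ⟨B, rfl⟩
    exact ⟨A * B, m2Map_mul hd h A B⟩
  rintro ⟨P, Q, R⟩
  have hP : ∃ A, m2Map g d h A = (P, 0, 0) := by
    have hsum : (P, 0, 0) = ∑ p, ((Pi.single p (P p), 0, 0) : ((Fin g × Fin g) → ZMod 2) ×
        ({p : Fin g × Fin g // p.1 < p.2} → ZMod 2) ×
        ({p : Fin g × Fin g // p.1 < p.2} → ZMod 2)) := by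
      simp [Prod.ext_iff, Prod.fst_sum, Prod.snd_sum, Finset.univ_sum_single]
    rw [hsum]
    exact Finset.sum_induction _ (fun x => ∃ A, m2Map g d h A = x) hadd
      (exists_m2Map_eq_upper hd h 0)
      fun p _ => exists_m2Map_eq_single hd hdeven h p (P p)
  simpa using hadd _ _ hP
    (hadd _ _ (exists_m2Map_eq_upper hd h Q) (exists_m2Map_eq_lower hd h R))

lemma m2Map_eq_zero_iff (hd : d ≠ 0) (h : Even (d ^ 2)) (A : ↥(GammaMod g (d ^ 2) h)) :
    m2Map g d h A = 0 ↔ (A : ↥(SpZ g)) ∈ Gamma g (2 * d ^ 2) := by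
  have hn : d ^ 2 ≠ 0 := pow_ne_zero 2 hd
  have hA := A.2.1
  simp only [mem_Gamma_iff, ← entryDiv_eq_zero_iff hn hA]
  constructor
  · intro h0
    simp only [m2Map, Prod.ext_iff, funext_iff, Prod.fst_zero, Prod.snd_zero, Pi.zero_apply] at h0
    obtain ⟨hp, hq, hr⟩ := h0
    rintro (i | i) (j | j)
    · exact hp (i, j)
    · rcases lt_trichotomy i j with hij | rfl | hij
      · exact hq ⟨(i, j), hij⟩
      · rw [entryDiv_eq_zero_iff hn hA]
        simpa using (A.2.2 i).1
      · rw [entryDiv_inl_inr_symm hn h hA]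
        exact hq ⟨(j, i), hij⟩
    · rcases lt_trichotomy i j with hij | rfl | hij
      · exact hr ⟨(i, j), hij⟩
      · rw [entryDiv_eq_zero_iff hn hA]
        simpa using (A.2.2 i).2
      · rw [entryDiv_inr_inl_symm hn h hA]
        exact hr ⟨(j, i), hij⟩
    · rw [entryDiv_inr_inr hn h hA]
      exact hp (j, i)
  · intro h0
    ext p <;> exact h0 _ _

end Surjectivity

/-- For even `d ≥ 2` and `g ≥ 2`, the map `m'_2` is a surjective group homomorphism with
kernel `Γ_g[2d²]`; hence it induces an isomorphism `Γ_g[d²,2d²]/Γ_g[2d²] ≅ (ℤ/2ℤ)^{2g²−g}`. -/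
theorem m2Map_hom_surjective_ker (g d : ℕ) (hg : 2 ≤ g) (hd : 2 ≤ d) (hdeven : Even d)
    (h : Even (d ^ 2)) :
    (∀ A B : ↥(GammaMod g (d ^ 2) h), m2Map g d h (A * B) = m2Map g d h A + m2Map g d h B) ∧
    Function.Surjective (m2Map g d h) ∧
    (∀ A : ↥(GammaMod g (d ^ 2) h),
      m2Map g d h A = 0 ↔ ((A : ↥(SpZ g)) ∈ Gamma g (2 * d ^ 2))) := by
  have hd0 : d ≠ 0 := by omega
  exact ⟨m2Map_mul hd0 h, m2Map_surjective hd0 hdeven h, m2Map_eq_zero_iff hd0 h⟩
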